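/- Let R be a commutative ring, let A be an m×n matrix over R, let i j : Fin m with i ≠ j, and let c ∈ R. Let B = A.updateRow i (A i + c • A j) be the matrix obtained from A by adding c times row j to row i. Then for every natural number r, the ideal of r×r minors of B equals the ideal of r×r minors of A: Minors(B, r) = Minors(A, r). -/

import Mathlib

/-- The ideal of `r × r` minors of a matrix `A`: the ideal generated by all determinants
of `r × r` submatrices of `A` obtained by choosing `r` rows and `r` columns injectively. -/
def minorsIdeal {R : Type*} [CommRing R] {m n : ℕ}
    (A : Matrix (Fin m) (Fin n) R) (r : ℕ) : Ideal R :=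
  Ideal.span {x : R | ∃ (f : Fin r → Fin m) (g : Fin r → Fin n),
    Function.Injective f ∧ Function.Injective g ∧ x = (A.submatrix f g).det}

theorem det_submatrix_mem_minorsIdeal {R : Type*} [CommRing R] {m n r : ℕ}
    (A : Matrix (Fin m) (Fin n) R) (f : Fin r → Fin m) {g : Fin r → Fin n}
    (hg : Function.Injective g) : (A.submatrix f g).det ∈ minorsIdeal A r := by
  by_cases hf : Function.Injective f
  · exact Ideal.subset_span ⟨f, g, hf, hg, rfl⟩
  · obtain ⟨a, b, hab, hne⟩ : ∃ a b, f a = f b ∧ a ≠ b := by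
      simpa [Function.Injective] using hf
    rw [Matrix.det_zero_of_row_eq hne (by ext x; simp [hab])]
    exact zero_mem _

theorem minorsIdeal_updateRow_add_smul_le {R : Type*} [CommRing R] {m n : ℕ}
    (A : Matrix (Fin m) (Fin n) R) (i j : Fin m) (c : R) (r : ℕ) :
    minorsIdeal (A.updateRow i (A i + c • A j)) r ≤ minorsIdeal A r := by
  refine Ideal.span_le.2 ?_
  rintro _ ⟨f, g, hf, hg, rfl⟩
  by_cases h : ∃ k, f k = i
  · obtain ⟨k, rfl⟩ := h
    have hB : (A.updateRow (f k) (A (f k) + c • A j)).submatrix f g =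
        (A.submatrix f g).updateRow k ((A.submatrix f g) k + c • fun x => A j (g x)) := by
      ext a x
      by_cases ha : a = k
      · subst ha; simp
      · simp [Matrix.updateRow_ne, ha, hf.ne ha]
    have hj : (A.submatrix f g).updateRow k (fun x => A j (g x)) =
        A.submatrix (Function.update f k j) g := by
      ext a x
      by_cases ha : a = k
      · subst ha; simp
      · simp [Matrix.updateRow_ne, ha]
    rw [hB, Matrix.det_updateRow_add, Matrix.det_updateRow_smul, Matrix.updateRow_eq_self, hj]
    exact add_mem (det_submatrix_mem_minorsIdeal A f hg)
      (Ideal.mul_mem_left _ _ (det_submatrix_mem_minorsIdeal A _ hg))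
  · push Not at h
    have hB : (A.updateRow i (A i + c • A j)).submatrix f g = A.submatrix f g := by
      ext a x
      simp [Matrix.updateRow_ne, h a]
    rw [hB]
    exact det_submatrix_mem_minorsIdeal A f hg

/-- Adding a scalar multiple of one row to another row does not change the ideals
of minors. -/
theorem minorsIdeal_add_row_multiple {R : Type*} [CommRing R] {m n : ℕ}
    (A : Matrix (Fin m) (Fin n) R) (i j : Fin m) (hij : i ≠ j) (c : R) (r : ℕ) :
    minorsIdeal (A.updateRow i (A i + c • A j)) r = minorsIdeal A r := by
  refine le_antisymm (minorsIdeal_updateRow_add_smul_le A i j c r) ?_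
  set B := A.updateRow i (A i + c • A j) with hB
  have hA : B.updateRow i (B i + (-c) • B j) = A := by
    ext a x
    by_cases ha : a = i
    · subst ha
      simp [hB, Matrix.updateRow_ne hij.symm]
    · simp [hB, Matrix.updateRow_ne ha]
  have h := minorsIdeal_updateRow_add_smul_le B i j (-c) r
  rwa [hA] at h
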